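/- Let 0 < ε < 1/200, q = 3 and B = {x ∈ [0,1) : |x − 1/3| < ε} ∪ {x ∈ [0,1) : |x − 5/7| < ε}. Then for every integer κ ≥ 0, U^κ = {|x − 1/3| < ε·4^{−κ}} ∪ {|x − 5/7| < ε·8^{−κ}} and Q^κ = {ε·4^{−(κ+1)} ≤ |x − 1/3| < ε·4^{−κ}} ∪ {ε·8^{−(κ+1)} ≤ |x − 5/7| < ε·8^{−κ}}. Consequently Leb(Q^κ) = (3/2)·ε·4^{−κ} + (7/4)·ε·8^{−κ}, Leb(Q⁰)/Leb(B) = 13/16, and for every κ ≥ 1, (Leb(Q^{κ−1}) − Leb(Q^κ))/Leb(Q⁰) = (9/26)·4^{−(κ−1)} + (49/104)·8^{−(κ−1)}; moreover Σ_{κ≥1} κ·[(9/26)·4^{−(κ−1)} + (49/104)·8^{−(κ−1)}] = 16/13, the reciprocal of 13/16. -/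

import Mathlib

open Set MeasureTheory

/-- The doubling map `x ↦ 2x mod 1` on `[0,1)`. -/
noncomputable def doubling (x : ℝ) : ℝ := Int.fract (2 * x)

/-- `U⁰ = B` and `U^{κ+1} = U^κ \ (U^κ ∩ ⋂_{i=1}^q T^{−i}((U^κ)ᶜ))`. -/
def Uset {Ω : Type*} (T : Ω → Ω) (B : Set Ω) (q : ℕ) : ℕ → Set Ω
  | 0 => B
  | κ + 1 =>
      Uset T B q κ \
        (Uset T B q κ ∩ ⋂ i ∈ Finset.Icc 1 q, T^[i] ⁻¹' (Uset T B q κ)ᶜ)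

/-- `Q^κ = U^κ ∩ ⋂_{i=1}^q T^{−i}((U^κ)ᶜ)`. -/
def Qset {Ω : Type*} (T : Ω → Ω) (B : Set Ω) (q : ℕ) (κ : ℕ) : Set Ω :=
  Uset T B q κ ∩ ⋂ i ∈ Finset.Icc 1 q, T^[i] ⁻¹' (Uset T B q κ)ᶜ

/-- The union of the intervals of radius `a` around `1 / 3` and of radius `b` around `5 / 7`. -/
def twoBalls (a b : ℝ) : Set ℝ :=
  {x ∈ Ico (0 : ℝ) 1 | |x - 1 / 3| < a} ∪ {x ∈ Ico (0 : ℝ) 1 | |x - 5 / 7| < b}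

theorem doubling_eq_of_mem {x y : ℝ} (n : ℤ) (h : 2 * x = y + n) (hy : y ∈ Ico (0 : ℝ) 1) :
    doubling x = y := by
  rw [doubling, h, Int.fract_add_intCast, Int.fract_eq_self.2 hy]

theorem iterate_doubling_near_third {x : ℝ} (hx : |x - 1 / 3| < 1 / 200) :
    doubling x = 2 * x ∧ doubling (doubling x) = 4 * x - 1 ∧
      doubling (doubling (doubling x)) = 8 * x - 2 := by
  rw [abs_lt] at hx
  have h1 : doubling x = 2 * x :=
    doubling_eq_of_mem 0 (by simp) ⟨by linarith, by linarith⟩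
  have h2 : doubling (2 * x) = 4 * x - 1 :=
    doubling_eq_of_mem 1 (by push_cast; ring) ⟨by linarith, by linarith⟩
  have h3 : doubling (4 * x - 1) = 8 * x - 2 :=
    doubling_eq_of_mem 0 (by push_cast; ring) ⟨by linarith, by linarith⟩
  simp [h1, h2, h3]

theorem iterate_doubling_near_five_sevenths {x : ℝ} (hx : |x - 5 / 7| < 1 / 200) :
    doubling x = 2 * x - 1 ∧ doubling (doubling x) = 4 * x - 2 ∧
      doubling (doubling (doubling x)) = 8 * x - 5 := by
  rw [abs_lt] at hx
  have h1 : doubling x = 2 * x - 1 :=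
    doubling_eq_of_mem 1 (by push_cast; ring) ⟨by linarith, by linarith⟩
  have h2 : doubling (2 * x - 1) = 4 * x - 2 :=
    doubling_eq_of_mem 0 (by push_cast; ring) ⟨by linarith, by linarith⟩
  have h3 : doubling (4 * x - 2) = 8 * x - 5 :=
    doubling_eq_of_mem 1 (by push_cast; ring) ⟨by linarith, by linarith⟩
  simp [h1, h2, h3]

theorem mem_twoBalls {a b x : ℝ} (ha : a ≤ 1 / 200) (hb : b ≤ 1 / 200) :
    x ∈ twoBalls a b ↔ |x - 1 / 3| < a ∨ |x - 5 / 7| < b := by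
  simp only [twoBalls, mem_union, mem_ofPred_eq, mem_Ico, abs_lt]
  constructor
  · tauto
  · rintro (h | h)
    · exact Or.inl ⟨⟨by linarith, by linarith⟩, h⟩
    · exact Or.inr ⟨⟨by linarith, by linarith⟩, h⟩

theorem twoBalls_return {a b x : ℝ} (ha : a ≤ 1 / 200) (hb : b ≤ 1 / 200)
    (hx : x ∈ twoBalls a b) :
    (doubling x ∈ twoBalls a b ∨ doubling (doubling x) ∈ twoBalls a b ∨
      doubling (doubling (doubling x)) ∈ twoBalls a b) ↔ x ∈ twoBalls (a / 4) (b / 8) := by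
  rw [mem_twoBalls ha hb] at hx
  have h4 : a / 4 ≤ 1 / 200 := by linarith
  have h8 : b / 8 ≤ 1 / 200 := by linarith
  rcases hx with hx | hx
  · obtain ⟨h1, h2, h3⟩ := iterate_doubling_near_third (hx.trans_le ha)
    rw [h3, h2, h1]
    simp only [mem_twoBalls ha hb, mem_twoBalls h4 h8, abs_lt] at hx ⊢
    constructor
    · rintro ((h | h) | (h | h) | h | h)
      all_goals first
        | (exfalso; linarith)
        | exact Or.inl ⟨by linarith, by linarith⟩
    · rintro (h | h)
      · exact Or.inr (Or.inl (Or.inl ⟨by linarith, by linarith⟩))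
      · exfalso; linarith
  · obtain ⟨h1, h2, h3⟩ := iterate_doubling_near_five_sevenths (hx.trans_le hb)
    rw [h3, h2, h1]
    simp only [mem_twoBalls ha hb, mem_twoBalls h4 h8, abs_lt] at hx ⊢
    constructor
    · rintro ((h | h) | (h | h) | h | h)
      all_goals first
        | (exfalso; linarith)
        | exact Or.inr ⟨by linarith, by linarith⟩
    · rintro (h | h)
      · exfalso; linarith
      · exact Or.inr (Or.inr (Or.inr ⟨by linarith, by linarith⟩))

theorem twoBalls_inter_no_return {a b : ℝ} (ha : a ≤ 1 / 200) (hb : b ≤ 1 / 200) :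
    twoBalls a b ∩ ⋂ i ∈ Finset.Icc 1 3, doubling^[i] ⁻¹' (twoBalls a b)ᶜ =
      twoBalls a b \ twoBalls (a / 4) (b / 8) := by
  ext x
  simp only [mem_inter_iff, mem_sdiff, and_congr_right_iff]
  intro hx
  rw [← twoBalls_return ha hb hx]
  have hIcc : Finset.Icc 1 3 = ({1, 2, 3} : Finset ℕ) := rfl
  simp [hIcc]

theorem twoBalls_div_subset {a b : ℝ} (ha : 0 ≤ a) (hb : 0 ≤ b) :
    twoBalls (a / 4) (b / 8) ⊆ twoBalls a b := by
  rintro x (⟨hI, h⟩ | ⟨hI, h⟩)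
  · exact Or.inl ⟨hI, h.trans_le (by linarith)⟩
  · exact Or.inr ⟨hI, h.trans_le (by linarith)⟩

theorem twoBalls_eq_union_ball {a b : ℝ} (ha : a ≤ 1 / 200) (hb : b ≤ 1 / 200) :
    twoBalls a b = Metric.ball (1 / 3) a ∪ Metric.ball (5 / 7) b := by
  ext x
  rw [mem_twoBalls ha hb, mem_union, Metric.mem_ball, Metric.mem_ball, Real.dist_eq, Real.dist_eq]

theorem volume_twoBalls {a b : ℝ} (ha0 : 0 ≤ a) (hb0 : 0 ≤ b) (ha : a ≤ 1 / 200)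
    (hb : b ≤ 1 / 200) : volume (twoBalls a b) = ENNReal.ofReal (2 * a + 2 * b) := by
  rw [twoBalls_eq_union_ball ha hb, measure_union _ Metric.isOpen_ball.measurableSet,
    Real.volume_ball, Real.volume_ball, ENNReal.ofReal_add (by linarith) (by linarith)]
  apply Metric.ball_disjoint_ball
  rw [Real.dist_eq, le_abs]
  right
  linarith

theorem volume_twoBalls_diff {a b : ℝ} (ha0 : 0 ≤ a) (hb0 : 0 ≤ b) (ha : a ≤ 1 / 200)
    (hb : b ≤ 1 / 200) :
    (volume (twoBalls a b \ twoBalls (a / 4) (b / 8))).toReal = 3 / 2 * a + 7 / 4 * b := by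
  have h4 : a / 4 ≤ 1 / 200 := by linarith
  have h8 : b / 8 ≤ 1 / 200 := by linarith
  have hmeas : MeasurableSet (twoBalls (a / 4) (b / 8)) := by
    rw [twoBalls_eq_union_ball h4 h8]
    exact (Metric.isOpen_ball.union Metric.isOpen_ball).measurableSet
  have hvol := volume_twoBalls (a := a / 4) (b := b / 8) (by linarith) (by linarith) h4 h8
  rw [measure_sdiff (twoBalls_div_subset ha0 hb0) hmeas.nullMeasurableSet
      (by rw [hvol]; exact ENNReal.ofReal_ne_top),
    hvol, volume_twoBalls ha0 hb0 ha hb, ← ENNReal.ofReal_sub _ (by linarith),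
    ENNReal.toReal_ofReal (by linarith)]
  ring

theorem twoBalls_diff_eq {a b : ℝ} (ha : a ≤ 1 / 200)
    (hb : b ≤ 1 / 200) :
    twoBalls a b \ twoBalls (a / 4) (b / 8) =
      {x ∈ Ico (0 : ℝ) 1 | a / 4 ≤ |x - 1 / 3| ∧ |x - 1 / 3| < a} ∪
        {x ∈ Ico (0 : ℝ) 1 | b / 8 ≤ |x - 5 / 7| ∧ |x - 5 / 7| < b} := by
  ext x
  have hfar : 1 / 100 < |x - 1 / 3| ∨ 1 / 100 < |x - 5 / 7| := by
    by_contra! h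
    rw [abs_le, abs_le] at h
    linarith
  simp only [twoBalls, mem_sdiff, mem_union, mem_ofPred_eq]
  constructor
  · rintro ⟨⟨hI, h⟩ | ⟨hI, h⟩, hn⟩
    · exact Or.inl ⟨hI, not_lt.1 fun h' => hn (Or.inl ⟨hI, h'⟩), h⟩
    · exact Or.inr ⟨hI, not_lt.1 fun h' => hn (Or.inr ⟨hI, h'⟩), h⟩
  · rintro (⟨hI, h, h'⟩ | ⟨hI, h, h'⟩)
    · refine ⟨Or.inl ⟨hI, h'⟩, ?_⟩
      rintro (⟨-, k⟩ | ⟨-, k⟩)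
      · linarith
      · rcases hfar with hfar | hfar <;> linarith
    · refine ⟨Or.inr ⟨hI, h'⟩, ?_⟩
      rintro (⟨-, k⟩ | ⟨-, k⟩)
      · rcases hfar with hfar | hfar <;> linarith
      · linarith

theorem div_pow_le_of_one_le {ε c : ℝ} (hε0 : 0 ≤ ε) (hc : 1 ≤ c) (κ : ℕ) : ε / c ^ κ ≤ ε :=
  div_le_self hε0 (one_le_pow₀ hc)

theorem Uset_twoBalls {ε : ℝ} (hε0 : 0 ≤ ε) (hε : ε ≤ 1 / 200) (κ : ℕ) :
    Uset doubling (twoBalls ε ε) 3 κ = twoBalls (ε / 4 ^ κ) (ε / 8 ^ κ) := by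
  induction κ with
  | zero => simp [Uset]
  | succ κ ih =>
    have h4 := (div_pow_le_of_one_le hε0 (c := 4) (by norm_num) κ).trans hε
    have h8 := (div_pow_le_of_one_le hε0 (c := 8) (by norm_num) κ).trans hε
    rw [Uset, ih, twoBalls_inter_no_return h4 h8, sdiff_sdiff_cancel_left
      (twoBalls_div_subset (by positivity) (by positivity)), div_div, div_div, ← pow_succ,
      ← pow_succ]

theorem Qset_twoBalls {ε : ℝ} (hε0 : 0 ≤ ε) (hε : ε ≤ 1 / 200) (κ : ℕ) :
    Qset doubling (twoBalls ε ε) 3 κ =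
      twoBalls (ε / 4 ^ κ) (ε / 8 ^ κ) \ twoBalls (ε / 4 ^ κ / 4) (ε / 8 ^ κ / 8) := by
  rw [Qset, Uset_twoBalls hε0 hε, twoBalls_inter_no_return
    ((div_pow_le_of_one_le hε0 (by norm_num) κ).trans hε)
    ((div_pow_le_of_one_le hε0 (by norm_num) κ).trans hε)]

theorem volume_Qset_twoBalls {ε : ℝ} (hε0 : 0 ≤ ε) (hε : ε ≤ 1 / 200) (κ : ℕ) :
    (volume (Qset doubling (twoBalls ε ε) 3 κ)).toReal =
      3 / 2 * ε / 4 ^ κ + 7 / 4 * ε / 8 ^ κ := by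
  rw [Qset_twoBalls hε0 hε, volume_twoBalls_diff (by positivity) (by positivity)
    ((div_pow_le_of_one_le hε0 (by norm_num) κ).trans hε)
    ((div_pow_le_of_one_le hε0 (by norm_num) κ).trans hε)]
  ring

theorem hasSum_succ_mul_geometric {r : ℝ} (hr : |r| < 1) :
    HasSum (fun j : ℕ => ((j : ℝ) + 1) * r ^ j) (1 / (1 - r) ^ 2) := by
  simpa using hasSum_choose_mul_geometric_of_norm_lt_one 1 (r := r) hr

theorem doubling_two_periodic_points {ε : ℝ} (hε0 : 0 < ε) (hε : ε < 1 / 200)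
    (B : Set ℝ)
    (hB : B = {x ∈ Ico (0 : ℝ) 1 | |x - 1 / 3| < ε} ∪
        {x ∈ Ico (0 : ℝ) 1 | |x - 5 / 7| < ε}) :
    (∀ κ : ℕ,
      Uset doubling B 3 κ
        = {x ∈ Ico (0 : ℝ) 1 | |x - 1 / 3| < ε / 4 ^ κ} ∪
          {x ∈ Ico (0 : ℝ) 1 | |x - 5 / 7| < ε / 8 ^ κ} ∧
      Qset doubling B 3 κ
        = {x ∈ Ico (0 : ℝ) 1 | ε / 4 ^ (κ + 1) ≤ |x - 1 / 3| ∧ |x - 1 / 3| < ε / 4 ^ κ} ∪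
          {x ∈ Ico (0 : ℝ) 1 | ε / 8 ^ (κ + 1) ≤ |x - 5 / 7| ∧ |x - 5 / 7| < ε / 8 ^ κ} ∧
      (volume (Qset doubling B 3 κ)).toReal
        = 3 / 2 * ε / 4 ^ κ + 7 / 4 * ε / 8 ^ κ) ∧
    (volume (Qset doubling B 3 0)).toReal / (volume B).toReal = 13 / 16 ∧
    (∀ κ : ℕ, 1 ≤ κ →
      ((volume (Qset doubling B 3 (κ - 1))).toReal
          - (volume (Qset doubling B 3 κ)).toReal)
        / (volume (Qset doubling B 3 0)).toReal
        = 9 / 26 / 4 ^ (κ - 1) + 49 / 104 / 8 ^ (κ - 1)) ∧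
    ∑' j : ℕ, ((j : ℝ) + 1) * (9 / 26 / 4 ^ j + 49 / 104 / 8 ^ j) = 16 / 13 := by
  obtain rfl : B = twoBalls ε ε := hB
  have hvol := volume_Qset_twoBalls hε0.le hε.le
  refine ⟨fun κ => ⟨Uset_twoBalls hε0.le hε.le κ, ?_, hvol κ⟩, ?_, ?_, ?_⟩
  · rw [Qset_twoBalls hε0.le hε.le, twoBalls_diff_eq
      ((div_pow_le_of_one_le hε0.le (by norm_num) κ).trans hε.le)
      ((div_pow_le_of_one_le hε0.le (by norm_num) κ).trans hε.le), div_div, div_div,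
      ← pow_succ, ← pow_succ]
  · rw [hvol, volume_twoBalls hε0.le hε0.le hε.le hε.le, ENNReal.toReal_ofReal (by linarith)]
    field_simp
    norm_num
  · intro κ hκ
    obtain ⟨k, rfl⟩ := Nat.exists_eq_add_of_le' hκ
    rw [hvol, hvol, hvol, Nat.add_sub_cancel, pow_succ, pow_succ]
    field_simp
    ring
  · have h4 := (hasSum_succ_mul_geometric (r := 1 / 4) (by norm_num [abs_lt])).mul_left (9 / 26)
    have h8 := (hasSum_succ_mul_geometric (r := 1 / 8) (by norm_num [abs_lt])).mul_left (49 / 104)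
    convert (h4.add h8).tsum_eq using 1
    · congr 1
      ext j
      simp only [one_div, inv_pow]
      ring
    · norm_num
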